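/- arXiv:1603.02127 — 12 statements merged into one kernel-verified Lean document; each statement's English description precedes it below -/
import Mathlib

section
/- Let m : ℤ → ℤ → ℝ be an n-periodic tame frieze lattice (n ≥ 1) with quiddity row a i := m i i. Then the difference between entries lying directly above/below one another in rows n and n−2 is constant: for every k ∈ ℤ, m (k+1) (k+n) − m (k+2) (k+n−1) = m 1 n − m 2 (n−1). -/
/-- **Theorem (constant row difference).**
Let `m : ℤ → ℤ → ℝ` be an `n`-periodic tame frieze lattice (`n ≥ 1`) with quiddity row
`a i := m i i`.  Then the difference between entries lying directly above/below one another in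
rows `n` and `n − 2` is constant: for every `k : ℤ`,
`m (k+1) (k+n) − m (k+2) (k+n−1) = m 1 n − m 2 (n−1)`. -/
theorem frieze_row_difference_constant
    (n : ℤ) (hn : 1 ≤ n) (m : ℤ → ℤ → ℝ)
    (hone : ∀ i : ℤ, m i (i - 1) = 1)
    (hzero : ∀ i : ℤ, m i (i - 2) = 0)
    (hrow : ∀ i j : ℤ, m i j = m j j * m i (j - 1) - m i (j - 2))
    (hcol : ∀ i j : ℤ, m i j = m i i * m (i + 1) j - m (i + 2) j)
    (hper : ∀ i j : ℤ, m (i + n) (j + n) = m i j) :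
    ∀ k : ℤ, m (k + 1) (k + n) - m (k + 2) (k + n - 1) = m 1 n - m 2 (n - 1) := by
  have step : ∀ k : ℤ, m (k + 1 + 1) (k + 1 + n) - m (k + 1 + 2) (k + 1 + n - 1) =
      m (k + 1) (k + n) - m (k + 2) (k + n - 1) := by
    intro k
    have hr := hrow (k + 1 + 1) (k + 1 + n)
    have hc := hcol (k + 1) (k + n)
    rw [hper, show k + 1 + n - 1 = k + n by ring, show k + 1 + n - 2 = k + n - 1 by ring] at hr
    rw [show k + 1 + n - 1 = k + n by ring, hr, hc, show k + 2 = k + 1 + 1 by ring]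
    ring
  intro k
  induction k using Int.induction_on with
  | zero => simp
  | succ k ih => rw [step, ih]
  | pred k ih =>
    rw [← step, sub_add_cancel]
    exact ih
end

section
/- Let m : ℤ → ℤ → ℝ be an n-periodic tame frieze lattice (n ≥ 1), and set s_q := m 1 n − m 2 (n−1). Then for all i, j ∈ ℤ: (i) m i (j+2n) = s_q · m i (j+n) − m i j, and (ii) m (i−2n) j = s_q · m (i−n) j − m i j. -/
/-- A solution of a discrete Hill equation with two consecutive zeros vanishes. -/
theorem eq_zero_of_recurrence {a f : ℤ → ℝ}
    (hf : ∀ j, f j = a j * f (j - 1) - f (j - 2)) (h0 : f 0 = 0) (h1 : f (-1) = 0) (j : ℤ) :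
    f j = 0 := by
  suffices h : f j = 0 ∧ f (j - 1) = 0 from h.1
  induction j with
  | zero => exact ⟨h0, by simpa using h1⟩
  | succ k ih =>
    have h := hf (k + 1)
    rw [show (k : ℤ) + 1 - 1 = k by ring, show (k : ℤ) + 1 - 2 = k - 1 by ring, ih.1, ih.2] at h
    exact ⟨by simpa using h, by simpa using ih.1⟩
  | pred k ih =>
    have h := hf (-k)
    rw [ih.1, ih.2] at h
    refine ⟨ih.2, ?_⟩
    rw [show -(k : ℤ) - 1 - 1 = -k - 2 by ring]
    linarith

/-- The discrete Wronskian of two solutions of a discrete Hill equation is constant. -/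
theorem wronskian_eq_of_recurrence {a f g : ℤ → ℝ}
    (hf : ∀ j, f j = a j * f (j - 1) - f (j - 2))
    (hg : ∀ j, g j = a j * g (j - 1) - g (j - 2)) (j : ℤ) :
    f (j - 1) * g j - f j * g (j - 1) = f (-1) * g 0 - f 0 * g (-1) := by
  have step (k : ℤ) : f (k - 1) * g k - f k * g (k - 1) =
      f (k - 1 - 1) * g (k - 1) - f (k - 1) * g (k - 1 - 1) := by
    rw [hf k, hg k, show k - 1 - 1 = k - 2 by ring]
    ring
  induction j with
  | zero => simp
  | succ k ih =>
    have h := step (k + 1)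
    rw [show (k : ℤ) + 1 - 1 = k by ring] at h ⊢
    exact h.trans ih
  | pred k ih => exact (step (-k)).symm.trans ih


/-- **Theorem (recursion with the growth coefficient).**
Let `m : ℤ → ℤ → ℝ` be an `n`-periodic tame frieze lattice (`n ≥ 1`) and set
`s_q := m 1 n − m 2 (n−1)`.  Then for all `i j : ℤ`:
(i) `m i (j+2n) = s_q · m i (j+n) − m i j` and
(ii) `m (i−2n) j = s_q · m (i−n) j − m i j`. -/
theorem frieze_growth_recursion
    (n : ℤ) (hn : 1 ≤ n) (m : ℤ → ℤ → ℝ)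
    (hone : ∀ i : ℤ, m i (i - 1) = 1)
    (hzero : ∀ i : ℤ, m i (i - 2) = 0)
    (hrow : ∀ i j : ℤ, m i j = m j j * m i (j - 1) - m i (j - 2))
    (hcol : ∀ i j : ℤ, m i j = m i i * m (i + 1) j - m (i + 2) j)
    (hper : ∀ i j : ℤ, m (i + n) (j + n) = m i j) :
    ∀ i j : ℤ,
      m i (j + 2 * n) = (m 1 n - m 2 (n - 1)) * m i (j + n) - m i j ∧
      m (i - 2 * n) j = (m 1 n - m 2 (n - 1)) * m (i - n) j - m i j := by
  have hthree : m 2 (-1) = -1 := by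
    have h := hrow 2 1
    have h1 := hone 2
    have h2 := hzero 2
    norm_num at h h1 h2
    rw [h1, h2] at h
    linarith
  have hm10 : m 1 0 = 1 := by simpa using hone 1
  have hm11 : m 1 (-1) = 0 := by simpa using hzero 1
  have hm20 : m 2 0 = 0 := by simpa using hzero 2
  have hdet : m 1 (n - 1) * m 2 n - m 1 n * m 2 (n - 1) = 1 := by
    rw [wronskian_eq_of_recurrence (hrow 1) (hrow 2) n, hm10, hm11, hthree]
    norm_num
  have hshift (i : ℤ) (t j : ℤ) (ht : m (j + t) (j + t) = m j j) :
      m i (j + t) = m j j * m i (j - 1 + t) - m i (j - 2 + t) := by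
    rw [hrow i (j + t), ht, show j + t - 1 = j - 1 + t by ring,
      show j + t - 2 = j - 2 + t by ring]
  have hper2 (i j : ℤ) : m (i + 2 * n) (j + 2 * n) = m i j := by
    rw [← hper i j, ← hper (i + n), two_mul, ← add_assoc, ← add_assoc]
  have hbasis (f : ℤ → ℝ) (hf : ∀ j, f j = m j j * f (j - 1) - f (j - 2)) (j : ℤ) :
      f j = m 1 j * f 0 - m 2 j * f (-1) := by
    have h := eq_zero_of_recurrence (a := fun j => m j j)
      (f := fun j => f j - (m 1 j * f 0 - m 2 j * f (-1)))
      (fun j => by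
        rw [hf j, hrow 1 j, hrow 2 j]
        ring)
      (by simp [hm10, hm20]) (by simp [hm11, hthree]) j
    exact sub_eq_zero.mp h
  have key (i j : ℤ) :
      m i (j + 2 * n) = (m 1 n - m 2 (n - 1)) * m i (j + n) - m i j := by
    have hfn := hbasis (m i) (hrow i)
    have hf2n := hbasis (fun j => m i (j + n)) (fun j => hshift i n j (hper j j))
    have e1 := hfn n
    have e2 := hfn (n - 1)
    have e3 := hf2n n
    have e4 := hf2n (n - 1)
    rw [zero_add, neg_add_eq_sub] at e3 e4
    have h := eq_zero_of_recurrence (a := fun j => m j j)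
      (f := fun j => m i (j + 2 * n) - ((m 1 n - m 2 (n - 1)) * m i (j + n) - m i j))
      (fun j => by
        rw [hshift i (2 * n) j (hper2 j j), hshift i n j (hper j j), hrow i j]
        ring)
      (by
        rw [zero_add, zero_add, two_mul, e3, e2, e1]
        linear_combination (-m i 0) * hdet)
      (by
        rw [neg_add_eq_sub, neg_add_eq_sub, show 2 * n - 1 = n - 1 + n by ring, e4, e2, e1]
        linear_combination (-m i (-1)) * hdet) j
    exact sub_eq_zero.mp h
  intro i j
  refine ⟨key i j, ?_⟩
  rw [← hper2 (i - 2 * n) j, ← hper (i - n) j, sub_add_cancel, sub_add_cancel]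
  exact key i j
end

section
/- Let m : ℤ → ℤ → ℝ be an n-periodic tame frieze lattice (n ≥ 1). Define s : ℕ → ℝ by s 0 := 2 and s k := m 1 (k·n) − m 2 (k·n − 1) for k ≥ 1. Then for all k ≥ 0 and all i, j ∈ ℤ: m i (j + 2·k·n) = s k · m i (j + k·n) − m i j, and m (i − 2·k·n) j = s k · m (i − k·n) j − m i j. -/
/-- A real sequence satisfying the recursion `f j = a j * f (j - 1) - f (j - 2)` of the rows of a
frieze lattice with quiddity row `a`. -/
def IsFriezeRow (a f : ℤ → ℝ) : Prop :=
  ∀ j : ℤ, f j = a j * f (j - 1) - f (j - 2)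

namespace IsFriezeRow

variable {a f u v : ℤ → ℝ}

theorem succ (hf : IsFriezeRow a f) (j : ℤ) : f (j + 1) = a (j + 1) * f j - f (j - 1) := by
  have h := hf (j + 1)
  rwa [show j + 1 - 1 = j by ring, show j + 1 - 2 = j - 1 by ring] at h

theorem shift (hf : IsFriezeRow a f) {N : ℤ} (ha : ∀ j, a (j + N) = a j) :
    IsFriezeRow a (fun j => f (j + N)) := by
  intro j
  have h := hf (j + N)
  rwa [ha, show j + N - 1 = j - 1 + N by ring, show j + N - 2 = j - 2 + N by ring] at h

theorem eq_comb (hf : IsFriezeRow a f) (hu : IsFriezeRow a u) (hv : IsFriezeRow a v)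
    (hu₀ : u 0 = 1) (hu₁ : u (-1) = 0) (hv₀ : v 0 = 0) (hv₁ : v (-1) = -1) (j : ℤ) :
    f j = f 0 * u j - f (-1) * v j := by
  suffices h : f j = f 0 * u j - f (-1) * v j ∧
      f (j - 1) = f 0 * u (j - 1) - f (-1) * v (j - 1) from h.1
  induction j using Int.induction_on with
  | zero => simp [hu₀, hu₁, hv₀, hv₁]
  | succ i ih =>
    rw [add_sub_cancel_right, hf.succ, hu.succ, hv.succ, ih.1, ih.2]
    constructor <;> ring
  | pred i ih =>
    refine ⟨ih.2, ?_⟩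
    rw [show (-(i : ℤ) - 1 - 1) = -i - 2 by ring]
    linear_combination a (-i) * ih.2 - ih.1 + hf (-i) - f 0 * hu (-i) + f (-1) * hv (-i)

theorem casoratian_eq (hu : IsFriezeRow a u) (hv : IsFriezeRow a v) (j : ℤ) :
    u j * v (j - 1) - u (j - 1) * v j = u 0 * v (-1) - u (-1) * v 0 := by
  induction j using Int.induction_on with
  | zero => simp
  | succ i ih =>
    rw [add_sub_cancel_right, hu.succ, hv.succ]
    linear_combination ih
  | pred i ih =>
    rw [show (-(i : ℤ) - 1 - 1) = -i - 2 by ring]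
    linear_combination ih - v (-i - 1) * hu (-i) + u (-i - 1) * hv (-i)

/-- Cayley-Hamilton for the monodromy of a frieze recursion whose quiddity row has period `N`. -/
theorem add_two_mul_period (hf : IsFriezeRow a f) (hu : IsFriezeRow a u) (hv : IsFriezeRow a v)
    (hu₀ : u 0 = 1) (hu₁ : u (-1) = 0) (hv₀ : v 0 = 0) (hv₁ : v (-1) = -1)
    {N : ℤ} (ha : ∀ j, a (j + N) = a j) (j : ℤ) :
    f (j + 2 * N) = (u N - v (N - 1)) * f (j + N) - f j := by
  have hcomb {g : ℤ → ℝ} (hg : IsFriezeRow a g) := hg.eq_comb hu hv hu₀ hu₁ hv₀ hv₁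
  have hshift {g : ℤ → ℝ} (hg : IsFriezeRow a g) (l : ℤ) :
      g (l + N) = g N * u l - g (N - 1) * v l := by
    have h := hcomb (hg.shift ha) l
    simpa only [zero_add, neg_add_eq_sub] using h
  have hdet : u N * v (N - 1) - u (N - 1) * v N = -1 := by
    rw [casoratian_eq hu hv, hu₀, hu₁, hv₀, hv₁]
    ring
  rw [show j + 2 * N = j + N + N by ring, hshift hf (j + N), hshift hu j, hshift hv j,
    hshift hf j, hcomb hf N, hcomb hf (N - 1), hcomb hf j]
  linear_combination (f 0 * u j - f (-1) * v j) * hdet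

end IsFriezeRow

theorem map_add_nat_mul_of_map_add {m : ℤ → ℤ → ℝ} {n : ℤ}
    (hper : ∀ i j : ℤ, m (i + n) (j + n) = m i j) (k : ℕ) (i j : ℤ) :
    m (i + k * n) (j + k * n) = m i j := by
  induction k with
  | zero => simp
  | succ k ih =>
    rw [← ih, ← hper (i + k * n)]
    congr 1 <;> push_cast <;> ring


/-- **Corollary (recursion with all growth coefficients).**
Let `m : ℤ → ℤ → ℝ` be an `n`-periodic tame frieze lattice (`n ≥ 1`), and define
`s : ℕ → ℝ` by `s 0 := 2` and `s k := m 1 (k·n) − m 2 (k·n − 1)` for `k ≥ 1`.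
Then for all `k ≥ 0` and all `i j : ℤ`:
`m i (j + 2kn) = s k · m i (j + kn) − m i j` and
`m (i − 2kn) j = s k · m (i − kn) j − m i j`. -/
theorem frieze_growth_recursion_all_coefficients
    (n : ℤ) (hn : 1 ≤ n) (m : ℤ → ℤ → ℝ)
    (hone : ∀ i : ℤ, m i (i - 1) = 1)
    (hzero : ∀ i : ℤ, m i (i - 2) = 0)
    (hrow : ∀ i j : ℤ, m i j = m j j * m i (j - 1) - m i (j - 2))
    (hcol : ∀ i j : ℤ, m i j = m i i * m (i + 1) j - m (i + 2) j)
    (hper : ∀ i j : ℤ, m (i + n) (j + n) = m i j)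
    (s : ℕ → ℝ) (hs0 : s 0 = 2)
    (hsk : ∀ k : ℕ, 1 ≤ k → s k = m 1 ((k : ℤ) * n) - m 2 ((k : ℤ) * n - 1)) :
    ∀ (k : ℕ) (i j : ℤ),
      m i (j + 2 * (k : ℤ) * n) = s k * m i (j + (k : ℤ) * n) - m i j ∧
      m (i - 2 * (k : ℤ) * n) j = s k * m (i - (k : ℤ) * n) j - m i j := by
  intro k i j
  have hN := map_add_nat_mul_of_map_add hper k
  have hm (i : ℤ) : IsFriezeRow (fun j => m j j) (m i) := hrow i
  have h10 : m 1 0 = 1 := by simpa using hone 1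
  have h11 : m 1 (-1) = 0 := by simpa using hzero 1
  have h20 : m 2 0 = 0 := by simpa using hzero 2
  have h21 : m 2 (-1) = -1 := by
    have h₁ : m 2 1 = 1 := by simpa using hone 2
    have h₂ := (hm 2).succ 0
    simp only [zero_add, zero_sub] at h₂
    linear_combination m 1 1 * h20 - h₁ + h₂
  have hs : s k = m 1 (k * n) - m 2 (k * n - 1) := by
    rcases Nat.eq_zero_or_pos k with rfl | hk
    · norm_num [hs0, h10, h21]
    · exact hsk k hk
  have hrec : m i (j + 2 * k * n) = s k * m i (j + k * n) - m i j := by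
    rw [hs, mul_assoc]
    exact (hm i).add_two_mul_period (hm 1) (hm 2) h10 h11 h20 h21 (fun j => hN j j) j
  refine ⟨hrec, ?_⟩
  have h₁ : m (i - k * n) j = m i (j + k * n) := by
    rw [← hN (i - k * n) j, sub_add_cancel]
  have h₂ : m (i - 2 * k * n) j = m i (j + 2 * k * n) := by
    rw [← hN (i - 2 * k * n) j, ← hN (i - 2 * k * n + k * n)]
    congr 1 <;> ring
  rw [h₁, h₂, hrec]
end

section
/- Let m : ℤ → ℤ → ℝ be an n-periodic tame frieze lattice (n ≥ 1), and let s : ℕ → ℝ be its sequence of growth coefficients, s 0 := 2 and s k := m 1 (k·n) − m 2 (k·n − 1) for k ≥ 1. Then the growth coefficients satisfy the recursion s (k+2) = s 1 · s (k+1) − s k for all k ≥ 0. -/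
/-- A row of a tame frieze lattice expands, to the right of any column `c`, in the rows
`c + 1` and `c + 2`. -/
theorem frieze_row_expansion {m : ℤ → ℤ → ℝ}
    (hone : ∀ i : ℤ, m i (i - 1) = 1) (hzero : ∀ i : ℤ, m i (i - 2) = 0)
    (hrow : ∀ i j : ℤ, m i j = m j j * m i (j - 1) - m i (j - 2)) (i c : ℤ) (t : ℕ) :
    m i (c + t) = m i c * m (c + 1) (c + t) - m i (c - 1) * m (c + 2) (c + t) ∧
    m i (c + t - 1) =
      m i c * m (c + 1) (c + t - 1) - m i (c - 1) * m (c + 2) (c + t - 1) := by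
  induction t with
  | zero =>
    have h1 : m (c + 1) c = 1 := by simpa using hone (c + 1)
    have h2 : m (c + 2) c = 0 := by simpa using hzero (c + 2)
    have h3 : m (c + 1) (c - 1) = 0 := by
      simpa [show c + 1 - 2 = c - 1 by ring] using hzero (c + 1)
    have h4 : m (c + 2) (c - 1) = -1 := by
      have h := hrow (c + 2) (c + 1)
      have h5 : m (c + 2) (c + 1) = 1 := by
        simpa [show c + 2 - 1 = c + 1 by ring] using hone (c + 2)
      rw [show c + 1 - 1 = c by ring, show c + 1 - 2 = c - 1 by ring, h2, h5] at h
      linarith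
    simp [h1, h2, h3, h4]
  | succ t ih =>
    obtain ⟨ih1, ih2⟩ := ih
    have hr (l : ℤ) : m l (c + (t + 1 : ℕ)) =
        m (c + (t + 1 : ℕ)) (c + (t + 1 : ℕ)) * m l (c + t) - m l (c + t - 1) := by
      have h := hrow l (c + (t + 1 : ℕ))
      rwa [show c + ((t + 1 : ℕ) : ℤ) - 1 = c + t by push_cast; ring,
        show c + ((t + 1 : ℕ) : ℤ) - 2 = c + t - 1 by push_cast; ring] at h
    have hs : c + ((t + 1 : ℕ) : ℤ) - 1 = c + t := by push_cast; ring
    refine ⟨?_, by rw [hs]; exact ih1⟩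
    rw [hr i, hr (c + 1), hr (c + 2)]
    linear_combination m (c + (t + 1 : ℕ)) (c + (t + 1 : ℕ)) * ih1 - ih2

/-- The `2 × 2` minors of the first two rows of a tame frieze lattice are constant. -/
theorem frieze_minor {m : ℤ → ℤ → ℝ}
    (hone : ∀ i : ℤ, m i (i - 1) = 1) (hzero : ∀ i : ℤ, m i (i - 2) = 0)
    (hrow : ∀ i j : ℤ, m i j = m j j * m i (j - 1) - m i (j - 2)) (t : ℕ) :
    m 1 (t + 1) * m 2 t - m 1 t * m 2 (t + 1) = -1 := by
  induction t with
  | zero =>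
    have h1 : m 1 0 = 1 := by simpa using hone 1
    have h2 : m 2 0 = 0 := by simpa using hzero 2
    have h3 : m 2 1 = 1 := by simpa using hone 2
    simp [h1, h2, h3]
  | succ t ih =>
    have hr (l : ℤ) : m l ((t + 1 : ℕ) + 1) =
        m ((t + 1 : ℕ) + 1) ((t + 1 : ℕ) + 1) * m l (t + 1) - m l t := by
      have h := hrow l ((t + 1 : ℕ) + 1)
      rwa [show ((t + 1 : ℕ) : ℤ) + 1 - 1 = t + 1 by push_cast; ring,
        show ((t + 1 : ℕ) : ℤ) + 1 - 2 = t by push_cast; ring] at h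
    rw [hr 1, hr 2, Nat.cast_succ]
    linear_combination ih

/-- A periodic frieze lattice is invariant under multiples of its period. -/
theorem frieze_periodic_nat_mul {n : ℤ} {m : ℤ → ℤ → ℝ}
    (hper : ∀ i j : ℤ, m (i + n) (j + n) = m i j) (i j : ℤ) (k : ℕ) :
    m (k * n + i) (k * n + j) = m i j := by
  induction k with
  | zero => simp
  | succ k ih =>
    rw [← ih, ← hper (k * n + i) (k * n + j)]
    congr 1 <;> push_cast <;> ring

/-- **Proposition (recursion among growth coefficients).**
Let `m : ℤ → ℤ → ℝ` be an `n`-periodic tame frieze lattice (`n ≥ 1`) and let `s : ℕ → ℝ`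
be its sequence of growth coefficients, `s 0 := 2` and `s k := m 1 (k·n) − m 2 (k·n − 1)`
for `k ≥ 1`.  Then `s (k+2) = s 1 · s (k+1) − s k` for all `k ≥ 0`. -/
theorem frieze_growth_coefficients_recursion
    (n : ℤ) (hn : 1 ≤ n) (m : ℤ → ℤ → ℝ)
    (hone : ∀ i : ℤ, m i (i - 1) = 1)
    (hzero : ∀ i : ℤ, m i (i - 2) = 0)
    (hrow : ∀ i j : ℤ, m i j = m j j * m i (j - 1) - m i (j - 2))
    (hcol : ∀ i j : ℤ, m i j = m i i * m (i + 1) j - m (i + 2) j)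
    (hper : ∀ i j : ℤ, m (i + n) (j + n) = m i j)
    (s : ℕ → ℝ) (hs0 : s 0 = 2)
    (hsk : ∀ k : ℕ, 1 ≤ k → s k = m 1 ((k : ℤ) * n) - m 2 ((k : ℤ) * n - 1)) :
    ∀ k : ℕ, s (k + 2) = s 1 * s (k + 1) - s k := by
  have hstep (i : ℤ) (k : ℕ) :
      m i ((k + 1 : ℕ) * n) = m i (k * n) * m 1 n - m i (k * n - 1) * m 2 n ∧
      m i ((k + 1 : ℕ) * n - 1) =
        m i (k * n) * m 1 (n - 1) - m i (k * n - 1) * m 2 (n - 1) := by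
    have h := frieze_row_expansion hone hzero hrow i (k * n) n.toNat
    rw [Int.toNat_of_nonneg (by lia), add_sub_assoc] at h
    simp only [frieze_periodic_nat_mul hper] at h
    rw [show ((k + 1 : ℕ) : ℤ) * n = k * n + n by push_cast; ring, add_sub_assoc]
    exact h
  have hdet : m 1 n * m 2 (n - 1) - m 1 (n - 1) * m 2 n = -1 := by
    have h := frieze_minor hone hzero hrow (n - 1).toNat
    rwa [Int.toNat_of_nonneg (by lia), sub_add_cancel] at h
  have htrace (k : ℕ) : s k = m 1 (k * n) - m 2 (k * n - 1) := by
    rcases Nat.eq_zero_or_pos k with rfl | hk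
    · have h1 : m 1 0 = 1 := by simpa using hone 1
      have h2 : m 2 (-1) = -1 := by
        have h := hrow 2 1
        have h3 : m 2 0 = 0 := by simpa using hzero 2
        have h4 : m 2 1 = 1 := by simpa using hone 2
        norm_num [h3, h4] at h
        linarith
      norm_num [hs0, h1, h2]
    · exact hsk k hk
  intro k
  obtain ⟨hA, hC⟩ := hstep 1 k
  obtain ⟨hB, hD⟩ := hstep 2 k
  have hA' := (hstep 1 (k + 1)).1
  have hD' := (hstep 2 (k + 1)).2
  rw [htrace (k + 2), htrace (k + 1), htrace k, htrace 1, hA', hD', hA, hB, hC, hD]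
  simp only [Nat.cast_one, one_mul]
  linear_combination (m 1 (k * n) - m 2 (k * n - 1)) * hdet
end

section
/- Let s : ℕ → ℝ satisfy s 0 = 2 and s (k+2) = s 1 · s (k+1) − s k for all k ≥ 0. Then for every k ≥ 1, s k = (s 1)^k + k · Σ_{l=1}^{⌊k/2⌋} (−1)^l · (1/(k−l)) · (binomial (k−l) l) · (s 1)^(k−2l). -/
/-- The `l`-th term of the closed formula for the Chebyshev-type polynomials
`u (n + 2) = x * u (n + 1) - u n`, `u 0 = 1`, `u 1 = x`. -/
noncomputable def chebyshevTerm (x : ℝ) (n l : ℕ) : ℝ :=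
  (-1) ^ l * ((n - l).choose l : ℝ) * x ^ (n - 2 * l)

/-- The Chebyshev-type polynomials of the second kind, evaluated at `x`. -/
noncomputable def chebyshevSum (x : ℝ) (n : ℕ) : ℝ :=
  ∑ l ∈ Finset.range (n / 2 + 1), chebyshevTerm x n l

lemma chebyshevTerm_zero (x : ℝ) (n : ℕ) : chebyshevTerm x n 0 = x ^ n := by
  simp [chebyshevTerm]

lemma chebyshevTerm_add_two_succ (x : ℝ) {n l : ℕ} (hl : l ≤ n) :
    chebyshevTerm x (n + 2) (l + 1) =
      x * chebyshevTerm x (n + 1) (l + 1) - chebyshevTerm x n l := by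
  unfold chebyshevTerm
  have e1 : n + 2 - (l + 1) = (n - l) + 1 := by omega
  have e2 : n + 1 - (l + 1) = n - l := by omega
  have e3 : n + 2 - 2 * (l + 1) = n - 2 * l := by omega
  rw [e1, e2, e3, Nat.choose_succ_succ]
  by_cases h : 2 * l + 1 ≤ n
  · have e4 : n - 2 * l = (n + 1 - 2 * (l + 1)) + 1 := by omega
    rw [e4]
    push_cast
    ring
  · rw [Nat.choose_eq_zero_of_lt (show n - l < l + 1 by omega)]
    push_cast
    ring

lemma chebyshevSum_succ_eq_sum (x : ℝ) (n : ℕ) :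
    chebyshevSum x (n + 1) =
      ∑ l ∈ Finset.range (n / 2 + 1 + 1), chebyshevTerm x (n + 1) l := by
  unfold chebyshevSum
  apply Finset.sum_subset
  · intro l
    simp only [Finset.mem_range]
    omega
  · intro l _ hl
    rw [Finset.mem_range] at hl
    simp [chebyshevTerm, Nat.choose_eq_zero_of_lt (show n + 1 - l < l by omega)]

lemma chebyshevSum_add_two (x : ℝ) (n : ℕ) :
    chebyshevSum x (n + 2) = x * chebyshevSum x (n + 1) - chebyshevSum x n := by
  rw [chebyshevSum_succ_eq_sum x n, chebyshevSum, chebyshevSum,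
    show (n + 2) / 2 + 1 = n / 2 + 1 + 1 by omega,
    Finset.sum_range_succ', Finset.sum_range_succ' (chebyshevTerm x (n + 1)),
    Finset.sum_congr rfl fun l hl => chebyshevTerm_add_two_succ x
      (show l ≤ n by rw [Finset.mem_range] at hl; omega),
    Finset.sum_sub_distrib, ← Finset.mul_sum, chebyshevTerm_zero, chebyshevTerm_zero]
  ring

lemma eq_chebyshevSum_sub_of_recurrence (s : ℕ → ℝ) (hs0 : s 0 = 2)
    (hrec : ∀ k : ℕ, s (k + 2) = s 1 * s (k + 1) - s k) (n : ℕ) :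
    s (n + 2) = chebyshevSum (s 1) (n + 2) - chebyshevSum (s 1) n := by
  have h0 : chebyshevSum (s 1) 0 = 1 := by simp [chebyshevSum, chebyshevTerm]
  have h1 : chebyshevSum (s 1) 1 = s 1 := by simp [chebyshevSum, chebyshevTerm]
  induction n using Nat.twoStepInduction with
  | zero =>
    rw [hrec 0, chebyshevSum_add_two, hs0, h0, zero_add, h1]
    ring
  | one =>
    rw [hrec 1, hrec 0, chebyshevSum_add_two, chebyshevSum_add_two, hs0, h0, zero_add, h1]
    ring
  | more n ih1 ih2 =>
    rw [hrec (n + 2), ih1, ih2, chebyshevSum_add_two _ (n + 2), chebyshevSum_add_two _ (n + 1),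
      chebyshevSum_add_two _ n]
    ring

lemma chebyshevTerm_add_two_sub (x : ℝ) {n l : ℕ} (hl : l ≤ n) :
    chebyshevTerm x (n + 2) (l + 1) - chebyshevTerm x n l =
      ((n + 2 : ℕ) : ℝ) * ((-1 : ℝ) ^ (l + 1) * (1 / (((n + 2 : ℕ) : ℝ) - ((l + 1 : ℕ) : ℝ))) *
        ((n + 2 - (l + 1)).choose (l + 1) : ℝ) * x ^ (n + 2 - 2 * (l + 1))) := by
  obtain ⟨m, rfl⟩ := Nat.exists_eq_add_of_le hl
  unfold chebyshevTerm
  have e1 : l + m + 2 - (l + 1) = m + 1 := by omega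
  have e2 : l + m - l = m := by omega
  have e3 : l + m + 2 - 2 * (l + 1) = l + m - 2 * l := by omega
  rw [e1, e2, e3]
  have key : ((m : ℝ) + 1) * (m.choose l : ℝ) = ((m + 1).choose (l + 1) : ℝ) * (l + 1) := by
    exact_mod_cast Nat.add_one_mul_choose_eq m l
  have hm : (m : ℝ) + 1 ≠ 0 := by positivity
  have e4 : ((l + m + 2 : ℕ) : ℝ) - ((l + 1 : ℕ) : ℝ) = m + 1 := by
    push_cast
    ring
  rw [e4, eq_div_of_mul_eq hm ((mul_comm _ _).trans key)]
  push_cast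
  field_simp
  ring


/-- **Proposition (closed formula for the growth coefficients).**
Let `s : ℕ → ℝ` satisfy `s 0 = 2` and `s (k+2) = s 1 · s (k+1) − s k` for all `k ≥ 0`.
Then for every `k ≥ 1`,
`s k = (s 1)^k + k · Σ_{l=1}^{⌊k/2⌋} (−1)^l (1/(k−l)) C(k−l, l) (s 1)^(k−2l)`. -/
theorem growth_coefficient_closed_formula
    (s : ℕ → ℝ) (hs0 : s 0 = 2)
    (hrec : ∀ k : ℕ, s (k + 2) = s 1 * s (k + 1) - s k) :
    ∀ k : ℕ, 1 ≤ k →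
      s k = (s 1) ^ k +
        (k : ℝ) * ∑ l ∈ Finset.Icc 1 (k / 2),
          (-1 : ℝ) ^ l * (1 / ((k : ℝ) - (l : ℝ))) * ((k - l).choose l : ℝ) *
            (s 1) ^ (k - 2 * l) := by
  intro k hk
  obtain rfl | ⟨n, rfl⟩ : k = 1 ∨ ∃ n, k = n + 2 := by
    obtain rfl | h := hk.eq_or_lt
    · exact Or.inl rfl
    · exact Or.inr ⟨k - 2, by omega⟩
  · simp
  · rw [eq_chebyshevSum_sub_of_recurrence s hs0 hrec, chebyshevSum, chebyshevSum,
      show (n + 2) / 2 = n / 2 + 1 by omega, Finset.sum_range_succ', chebyshevTerm_zero,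
      add_sub_right_comm, ← Finset.sum_sub_distrib, add_comm,
      ← Finset.Ico_add_one_right_eq_Icc, Finset.sum_Ico_eq_sum_range, Nat.add_sub_cancel,
      Finset.mul_sum]
    congr 1
    refine Finset.sum_congr rfl fun l hl => ?_
    rw [Finset.mem_range] at hl
    rw [add_comm 1 l]
    exact chebyshevTerm_add_two_sub (s 1) (by omega)
end

section
/- Let n ≥ 2 and let a : ℤ → ℤ be an n-periodic sequence of positive integers which is the quiddity sequence of an n-periodic infinite frieze of positive integers, with generated frieze m. Let â : ℤ → ℤ be the (n+1)-periodic sequence obtained from a by n-gluing above the pair (a 1, a 2), namely â 1 = a 1 + 1, â 2 = 1, â 3 = a 2 + 1 and â j = a (j−1) for 4 ≤ j ≤ n+1, and let m̂ be the infinite frieze generated by â. Then the growth coefficients of the two quiddity sequences agree: m̂ 1 (n+1) − m̂ 2 n = m 1 n − m 2 (n−1). -/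
/-- Two integer sequences satisfying the same second-order recurrence on `[k + 2, N]` and agreeing
at `k` and `k + 1` agree on `[k, N]`. -/
theorem eq_of_second_order_recurrence {u v c : ℤ → ℤ} {k N : ℤ}
    (h₀ : u k = v k) (h₁ : u (k + 1) = v (k + 1))
    (hu : ∀ j, k + 2 ≤ j → j ≤ N → u j = c j * u (j - 1) - u (j - 2))
    (hv : ∀ j, k + 2 ≤ j → j ≤ N → v j = c j * v (j - 1) - v (j - 2))
    {j : ℤ} (hkj : k ≤ j) (hjN : j ≤ N) : u j = v j := by
  have key : ∀ j, k ≤ j → j + 1 ≤ N → u j = v j ∧ u (j + 1) = v (j + 1) := by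
    intro j hj
    induction j, hj using Int.leInduction with
    | base => exact fun _ => ⟨h₀, h₁⟩
    | succ j hj ih =>
      intro hN
      obtain ⟨ih₀, ih₁⟩ := ih (by omega)
      refine ⟨ih₁, ?_⟩
      rw [hu _ (by omega) hN, hv _ (by omega) hN, show j + 1 + 1 - 1 = j + 1 by ring,
        show j + 1 + 1 - 2 = j by ring, ih₀, ih₁]
  rcases hkj.eq_or_lt with rfl | hlt
  · exact h₀
  · simpa using (key (j - 1) (by omega) (by omega)).2


/-- **Theorem (gluing leaves the growth coefficient invariant).**
Let `n ≥ 2` and let `a : ℤ → ℤ` be an `n`-periodic quiddity sequence of an `n`-periodic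
infinite frieze of positive integers, with generated frieze `m`.  Let `b` (the sequence `â`)
be the `(n+1)`-periodic sequence obtained from `a` by `n`-gluing above the pair `(a 1, a 2)`:
`b 1 = a 1 + 1`, `b 2 = 1`, `b 3 = a 2 + 1` and `b j = a (j−1)` for `4 ≤ j ≤ n+1`, and let
`mh` (the frieze `m̂`) be the infinite frieze generated by `b`.  Then the growth coefficients
of the two quiddity sequences agree: `m̂ 1 (n+1) − m̂ 2 n = m 1 n − m 2 (n−1)`. -/
theorem gluing_preserves_growth_coefficient
    (n : ℤ) (hn : 2 ≤ n) (a : ℤ → ℤ)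
    (hapos : ∀ i : ℤ, 1 ≤ a i)
    (haper : ∀ i : ℤ, a (i + n) = a i)
    (m : ℤ → ℤ → ℤ)
    (hm0 : ∀ i : ℤ, m i (i - 2) = 0)
    (hm1 : ∀ i : ℤ, m i (i - 1) = 1)
    (hmrec : ∀ i j : ℤ, i ≤ j → m i j = a j * m i (j - 1) - m i (j - 2))
    (hmpos : ∀ i j : ℤ, i ≤ j → 1 ≤ m i j)
    (b : ℤ → ℤ)
    (hb1 : b 1 = a 1 + 1) (hb2 : b 2 = 1) (hb3 : b 3 = a 2 + 1)
    (hbj : ∀ j : ℤ, 4 ≤ j → j ≤ n + 1 → b j = a (j - 1))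
    (hbper : ∀ i : ℤ, b (i + (n + 1)) = b i)
    (mh : ℤ → ℤ → ℤ)
    (hmh0 : ∀ i : ℤ, mh i (i - 2) = 0)
    (hmh1 : ∀ i : ℤ, mh i (i - 1) = 1)
    (hmhrec : ∀ i j : ℤ, i ≤ j → mh i j = b j * mh i (j - 1) - mh i (j - 2)) :
    mh 1 (n + 1) - mh 2 n = m 1 n - m 2 (n - 1) := by
  have shift : ∀ i, i ≤ 2 → mh i 2 = m i 1 → mh i 3 = m i 2 →
      ∀ j, 1 ≤ j → j ≤ n → mh i (j + 1) = m i j := by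
    intro i hi h₀ h₁ j hj hjn
    refine eq_of_second_order_recurrence (u := fun j => mh i (j + 1)) (v := m i) (c := a)
      (k := 1) (N := n) (by simpa using h₀) (by simpa using h₁) ?_ ?_ hj hjn
    · intro j hj hjn
      have hb := hbj (j + 1) (by omega) (by omega)
      have h := hmhrec i (j + 1) (by omega)
      rw [hb] at h
      convert h using 3 <;> ring_nf
    · exact fun j hj _ => hmrec i j (by omega)
  have m10 := hm1 1
  have m1m := hm0 1
  have m11 := hmrec 1 1 le_rfl
  have m12 := hmrec 1 2 (by norm_num)
  have m21 := hm1 2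
  have m20 := hm0 2
  have m22 := hmrec 2 2 le_rfl
  have q10 := hmh1 1
  have q1m := hmh0 1
  have q11 := hmhrec 1 1 le_rfl
  have q12 := hmhrec 1 2 (by norm_num)
  have q13 := hmhrec 1 3 (by norm_num)
  have q21 := hmh1 2
  have q20 := hmh0 2
  have q22 := hmhrec 2 2 le_rfl
  have q23 := hmhrec 2 3 (by norm_num)
  norm_num at m10 m1m m11 m12 m21 m20 m22 q10 q1m q11 q12 q13 q21 q20 q22 q23
  have e₁ : mh 1 (n + 1) = m 1 n := by
    refine shift 1 (by norm_num) ?_ ?_ n (by omega) le_rfl <;> grind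
  have e₂ : mh 2 n = m 2 (n - 1) := by
    have := shift 2 le_rfl (by grind) (by grind) (n - 1) (by omega) (by omega)
    simpa using this
  rw [e₁, e₂]
end

section
/- Let r ≥ 1 and let n_1, …, n_r, m_1, …, m_r be real numbers. Then the following continuant identity holds: P([m_r + 1, n_1, m_1, n_2, m_2, …, m_{r−1}, n_r]) − P([n_1, m_1, n_2, m_2, …, m_{r−1}, n_r]) + P([n_1, m_1, n_2, …, n_{r−1}, m_{r−1}]) = P([n_1, m_1, n_2, m_2, …, n_r, m_r]) + P([m_1, n_2, m_2, …, m_{r−1}, n_r]). (For r = 1, the lists [n_1,…,m_{r−1}] occurring above are interpreted as [ ] with P([ ]) = 1, and the list [m_1, n_2, …, n_r] as [ ].) -/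
/-- Auxiliary recursion on reversed lists: `contRev (x_k :: [x_{k-1}, …, x_1])` computes the
continuant `P(x_1, …, x_k)`. -/
noncomputable def contRev : List ℝ → ℝ
  | [] => 1
  | [x] => x
  | x :: y :: t => x * contRev (y :: t) + contRev t

/-- The continuant `P` of a list of real numbers: `P [] = 1`, `P [x] = x` and
`P [x_1, …, x_k] = x_k · P [x_1, …, x_{k−1}] + P [x_1, …, x_{k−2}]`. -/
noncomputable def continuant (l : List ℝ) : ℝ := contRev l.reverse

/-- The full alternating list `[n_1, m_1, n_2, m_2, …, n_r, m_r]`. -/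
def altList (nn mm : ℕ → ℝ) (r : ℕ) : List ℝ :=
  (List.range r).flatMap fun i => [nn (i + 1), mm (i + 1)]

theorem contRev_append_pair (x y : ℝ) :
    ∀ t : List ℝ, contRev (t ++ [y, x]) = x * contRev (t ++ [y]) + contRev t
  | [] => by simp [contRev]; ring
  | [a] => by simp [contRev]; ring
  | a :: b :: t => by
    have h₁ := contRev_append_pair x y (b :: t)
    have h₂ := contRev_append_pair x y t
    simp only [List.cons_append, contRev] at h₁ h₂ ⊢
    rw [h₁, h₂]
    ring

theorem continuant_cons_cons (x y : ℝ) (t : List ℝ) :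
    continuant (x :: y :: t) = x * continuant (y :: t) + continuant t := by
  simpa [continuant] using contRev_append_pair x y t.reverse

theorem continuant_append_pair (l : List ℝ) (x y : ℝ) :
    continuant (l ++ [y, x]) = x * continuant (l ++ [y]) + continuant l := by
  simp [continuant, contRev]

theorem continuant_cons_eq_tail {l : List ℝ} (hl : l ≠ []) (x : ℝ) :
    continuant (x :: l) = x * continuant l + continuant l.tail := by
  cases l with
  | nil => exact absurd rfl hl
  | cons y t => exact continuant_cons_cons x y t

theorem altList_succ (nn mm : ℕ → ℝ) (k : ℕ) :
    altList nn mm (k + 1) = altList nn mm k ++ [nn (k + 1), mm (k + 1)] := by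
  simp [altList, List.range_succ]

/-- **Continuant identity for the growth coefficient of a bridging triangulation.**
For `r ≥ 1` and reals `n_1, …, n_r, m_1, …, m_r`:
`P([m_r+1, n_1, m_1, …, m_{r−1}, n_r]) − P([n_1, m_1, …, m_{r−1}, n_r])
  + P([n_1, m_1, …, n_{r−1}, m_{r−1}])
  = P([n_1, m_1, …, n_r, m_r]) + P([m_1, n_2, …, m_{r−1}, n_r])`. -/
theorem continuant_growth_coefficient_identity
    (r : ℕ) (hr : 1 ≤ r) (nn mm : ℕ → ℝ) :
    continuant ((mm r + 1) :: (altList nn mm (r - 1) ++ [nn r]))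
      - continuant (altList nn mm (r - 1) ++ [nn r])
      + continuant (altList nn mm (r - 1))
    = continuant (altList nn mm r)
      + continuant ((altList nn mm (r - 1) ++ [nn r]).tail) := by
  obtain ⟨k, rfl⟩ := Nat.exists_eq_add_of_le' hr
  rw [Nat.add_sub_cancel, altList_succ, continuant_append_pair,
    continuant_cons_eq_tail (by simp)]
  ring
end

section
/- Let s : ℕ → ℝ satisfy s 0 = 2, s 1 ≥ 2 and s (k+2) = s 1 · s (k+1) − s k for all k ≥ 0. Then for all k ≥ 0: 2 ≤ s k and s k ≤ s (k+1). Moreover, if s 1 > 2, then s k < s (k+1) for all k ≥ 0. -/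
/-- **Lemma (monotonicity of the growth coefficients).**
Let `s : ℕ → ℝ` satisfy `s 0 = 2`, `s 1 ≥ 2` and `s (k+2) = s 1 · s (k+1) − s k`.
Then `2 ≤ s k` and `s k ≤ s (k+1)` for all `k ≥ 0`; if moreover `s 1 > 2`, the
inequalities `s k < s (k+1)` are strict. -/
theorem growth_coefficients_monotone
    (s : ℕ → ℝ) (hs0 : s 0 = 2) (hs1 : 2 ≤ s 1)
    (hrec : ∀ k : ℕ, s (k + 2) = s 1 * s (k + 1) - s k) :
    (∀ k : ℕ, 2 ≤ s k ∧ s k ≤ s (k + 1)) ∧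
    (2 < s 1 → ∀ k : ℕ, s k < s (k + 1)) := by
  have hmono : ∀ k : ℕ, 2 ≤ s k ∧ s k ≤ s (k + 1) := by
    intro k
    induction k with
    | zero => exact ⟨hs0.ge, by simpa [hs0] using hs1⟩
    | succ k ih =>
      obtain ⟨h2, hle⟩ := ih
      refine ⟨h2.trans hle, ?_⟩
      rw [hrec k]
      nlinarith [mul_nonneg (sub_nonneg.2 hs1) (zero_le_two.trans (h2.trans hle))]
  refine ⟨hmono, fun hlt k => ?_⟩
  cases k with
  | zero => simpa [hs0] using hlt
  | succ k =>
    obtain ⟨h2, hle⟩ := hmono k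
    rw [hrec k]
    nlinarith [mul_pos (sub_pos.2 hlt) (zero_lt_two.trans_le (h2.trans hle))]
end

section
/- Let s : ℕ → ℝ satisfy s 0 = 2, s 1 ≥ 2 and s (k+2) = s 1 · s (k+1) − s k for all k ≥ 0. Then the following are equivalent: (a) there exists k ≥ 1 with s k = 2; (b) s k = 2 for all k ≥ 0; (c) s 1 = 2. -/
theorem monotone_of_growth_recursion {s : ℕ → ℝ} (hs0 : s 0 = 2) (hs1 : 2 ≤ s 1)
    (hrec : ∀ k : ℕ, s (k + 2) = s 1 * s (k + 1) - s k) : Monotone s := by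
  have h : ∀ k, 2 ≤ s k ∧ s k ≤ s (k + 1) := by
    intro k
    induction k with
    | zero => exact ⟨hs0.ge, hs0.trans_le hs1⟩
    | succ k ih =>
      obtain ⟨h2, hle⟩ := ih
      refine ⟨h2.trans hle, ?_⟩
      rw [hrec k]
      nlinarith [mul_nonneg (sub_nonneg.2 hs1) (sub_nonneg.2 (h2.trans hle))]
  exact monotone_nat_of_le_succ fun k => (h k).2

theorem eq_two_of_growth_recursion {s : ℕ → ℝ} (hs0 : s 0 = 2) (hs1 : s 1 = 2)
    (hrec : ∀ k : ℕ, s (k + 2) = s 1 * s (k + 1) - s k) (k : ℕ) : s k = 2 := by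
  induction k using Nat.twoStepInduction with
  | zero => exact hs0
  | one => exact hs1
  | more k ih₀ ih₁ => rw [hrec, hs1, ih₀, ih₁]; norm_num


/-- **Proposition (characterisation of growth coefficient 2).**
Let `s : ℕ → ℝ` satisfy `s 0 = 2`, `s 1 ≥ 2` and `s (k+2) = s 1 · s (k+1) − s k`.
Then the following are equivalent: (a) there exists `k ≥ 1` with `s k = 2`;
(b) `s k = 2` for all `k ≥ 0`; (c) `s 1 = 2`. -/
theorem growth_coefficient_two_tfae
    (s : ℕ → ℝ) (hs0 : s 0 = 2) (hs1 : 2 ≤ s 1)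
    (hrec : ∀ k : ℕ, s (k + 2) = s 1 * s (k + 1) - s k) :
    ((∃ k : ℕ, 1 ≤ k ∧ s k = 2) ↔ (∀ k : ℕ, s k = 2)) ∧
    ((∀ k : ℕ, s k = 2) ↔ s 1 = 2) := by
  refine ⟨⟨?_, fun h => ⟨1, le_rfl, h 1⟩⟩, fun h => h 1, fun h =>
    eq_two_of_growth_recursion hs0 h hrec⟩
  rintro ⟨k, hk, hsk⟩
  have hle : s 1 ≤ s k := monotone_of_growth_recursion hs0 hs1 hrec hk
  exact eq_two_of_growth_recursion hs0 (le_antisymm (hle.trans_eq hsk) hs1) hrec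
end

section
/- Let s : ℕ → ℝ satisfy s 0 = 2, s 1 > 2, and s (k+2) = s 1 · s (k+1) − s k for all k ≥ 0. Set S := (s 1 + √((s 1)² − 4)) / 2, so S > 1. Then the sequence s is strictly monotonically increasing and grows asymptotically exponentially with rate S: for every ε with 0 < ε < S − 1 there exists K ∈ ℕ such that for all l ≥ 0, s K · (S − ε)^l ≤ s (K + l) ≤ s K · (S + ε)^l. -/
/-- A sequence with `s 0 = 2` and `s (k + 2) = s 1 * s (k + 1) - s k` is the power-sum sequence
of two numbers with sum `s 1` and product `1`. -/
lemma eq_pow_add_pow_of_linear_recurrence {R : Type*} [CommRing R] {s : ℕ → R} {S T : R}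
    (hs0 : s 0 = 2) (hrec : ∀ k, s (k + 2) = s 1 * s (k + 1) - s k)
    (hsum : S + T = s 1) (hprod : S * T = 1) (k : ℕ) : s k = S ^ k + T ^ k := by
  induction k using Nat.twoStepInduction with
  | zero => rw [hs0]; ring
  | one => rw [← hsum]; ring
  | more k ih₀ ih₁ =>
    rw [hrec, ih₀, ih₁, ← hsum]
    linear_combination (S ^ k + T ^ k) * hprod

lemma mul_pow_le_of_mul_le_succ {u : ℕ → ℝ} {r : ℝ} {K : ℕ} (hr : 0 ≤ r)
    (h : ∀ k, K ≤ k → r * u k ≤ u (k + 1)) (l : ℕ) : u K * r ^ l ≤ u (K + l) := by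
  rw [mul_comm]
  exact geom_le (u := fun l ↦ u (K + l)) hr l fun k _ ↦ h (K + k) (Nat.le_add_right K k)

lemma le_mul_pow_of_succ_le_mul {u : ℕ → ℝ} {r : ℝ} {K : ℕ} (hr : 0 ≤ r)
    (h : ∀ k, K ≤ k → u (k + 1) ≤ r * u k) (l : ℕ) : u (K + l) ≤ u K * r ^ l := by
  rw [mul_comm]
  exact le_geom (u := fun l ↦ u (K + l)) hr l fun k _ ↦ h (K + k) (Nat.le_add_right K k)


/-- **Proposition (asymptotically exponential growth of the growth coefficients).**
Let `s : ℕ → ℝ` satisfy `s 0 = 2`, `s 1 > 2` and `s (k+2) = s 1 · s (k+1) − s k`, and set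
`S := (s 1 + √((s 1)² − 4)) / 2`.  Then `S > 1`, the sequence `s` is strictly increasing,
and it grows asymptotically exponentially with rate `S`: for every `ε` with `0 < ε < S − 1`
there is `K : ℕ` such that `s K · (S − ε)^l ≤ s (K + l) ≤ s K · (S + ε)^l` for all `l ≥ 0`. -/
theorem growth_coefficients_asymptotically_exponential
    (s : ℕ → ℝ) (hs0 : s 0 = 2) (hs1 : 2 < s 1)
    (hrec : ∀ k : ℕ, s (k + 2) = s 1 * s (k + 1) - s k)
    (S : ℝ) (hS : S = (s 1 + Real.sqrt ((s 1) ^ 2 - 4)) / 2) :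
    1 < S ∧ StrictMono s ∧
    ∀ ε : ℝ, 0 < ε → ε < S - 1 →
      ∃ K : ℕ, ∀ l : ℕ,
        s K * (S - ε) ^ l ≤ s (K + l) ∧ s (K + l) ≤ s K * (S + ε) ^ l := by
  have hdisc : 0 < s 1 ^ 2 - 4 := by nlinarith
  have hsq := Real.sq_sqrt hdisc.le
  have hS1 : 1 < S := by linarith [Real.sqrt_pos.2 hdisc]
  have hroot : S * (s 1 - S) = 1 := by subst hS; linear_combination -hsq / 4
  obtain ⟨T, hT⟩ : ∃ T, T = s 1 - S := ⟨_, rfl⟩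
  have hprod : S * T = 1 := hT ▸ hroot
  have hform := eq_pow_add_pow_of_linear_recurrence hs0 hrec (by rw [hT]; ring) hprod
  have hT0 : 0 < T := by nlinarith
  have hT1 : T < 1 := by nlinarith
  have hTpow (k : ℕ) : 0 < T ^ k := pow_pos hT0 k
  have hpos (k : ℕ) : 0 < s k := by rw [hform]; positivity
  have hratio (k : ℕ) : s (k + 1) = S * s k - (S - T) * T ^ k := by
    rw [hform, hform]; ring
  refine ⟨hS1, strictMono_nat_of_lt_succ fun k ↦ ?_, fun ε hε hεS ↦ ?_⟩
  · have hdiff : s (k + 1) - s k = (S - 1) * (S ^ k - T ^ (k + 1)) := by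
      rw [hform, hform]
      linear_combination T ^ k * hprod
    have hlt : T ^ (k + 1) < S ^ k :=
      (pow_lt_one₀ hT0.le hT1 k.succ_ne_zero).trans_le (one_le_pow₀ hS1.le)
    linarith [mul_pos (sub_pos.2 hS1) (sub_pos.2 hlt)]
  · obtain ⟨K, hK⟩ := pow_unbounded_of_one_lt ((S - T) / ε) hS1
    refine ⟨K, fun l ↦ ⟨mul_pow_le_of_mul_le_succ (by linarith) (fun k hk ↦ ?_) l,
      le_mul_pow_of_succ_le_mul (by linarith) (fun k _ ↦ ?_) l⟩⟩
    · have hSK : S - T ≤ S ^ k * ε :=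
        ((div_lt_iff₀ hε).1 (hK.trans_le (pow_le_pow_right₀ hS1.le hk))).le
      have hTk : (S - T) * T ^ k ≤ S - T :=
        mul_le_of_le_one_right (by linarith) (pow_le_one₀ hT0.le hT1.le)
      have hsk : S ^ k * ε ≤ ε * s k := by
        rw [hform]; linarith [mul_pos hε (hTpow k)]
      linarith [hratio k]
    · have hgap : 0 < (S - T) * T ^ k := mul_pos (by linarith) (hTpow k)
      linarith [hratio k, mul_pos hε (hpos k)]
end

section
/- Let r : ℕ → ℝ satisfy r (k+2) = r 1 · r (k+1) − r k for all k ≥ 0, and let s : ℕ → ℝ satisfy s 0 = 2, s 1 = r 1 and s (k+2) = s 1 · s (k+1) − s k for all k ≥ 0. Then the generalised recursion formulas hold: for all p ≥ 0 and all k ≥ 0, r (k + 2p) = s p · r (k + p) − r k. -/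
/-- **Theorem (generalised recursion formulas).**
Let `r : ℕ → ℝ` satisfy `r (k+2) = r 1 · r (k+1) − r k` and let `s : ℕ → ℝ` satisfy the same
recursion with `s 0 = 2` and `s 1 = r 1`.  Then for all `p ≥ 0` and `k ≥ 0`,
`r (k + 2p) = s p · r (k + p) − r k`. -/
theorem generalised_recursion_formulas
    (r s : ℕ → ℝ)
    (hr : ∀ k : ℕ, r (k + 2) = r 1 * r (k + 1) - r k)
    (hs0 : s 0 = 2) (hs1 : s 1 = r 1)
    (hs : ∀ k : ℕ, s (k + 2) = s 1 * s (k + 1) - s k) :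
    ∀ p k : ℕ, r (k + 2 * p) = s p * r (k + p) - r k := by
  intro p
  induction p using Nat.twoStepInduction with
  | zero => intro k; simp only [Nat.mul_zero, Nat.add_zero, hs0]; ring
  | one => intro k; rw [hs1]; exact hr k
  | more p ih₀ ih₁ =>
    intro k
    have h₀ := ih₀ (k + 2)
    have h₁ := ih₁ (k + 1)
    rw [show k + 2 + 2 * p = k + 2 * p + 2 by ring, show k + 2 + p = k + (p + 2) by ring] at h₀
    rw [show k + 1 + 2 * (p + 1) = k + 2 * p + 2 + 1 by ring,
      show k + 1 + (p + 1) = k + (p + 2) by ring] at h₁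
    rw [show k + 2 * (p + 2) = k + 2 * p + 2 + 2 by ring, hs p, hs1]
    linear_combination hr (k + 2 * p + 2) + hr k + r 1 * h₁ - h₀
end

section
/- Let r : ℕ → ℝ satisfy r (k+2) = r 1 · r (k+1) − r k for all k ≥ 0, and let s : ℕ → ℝ satisfy s 0 = 2, s 1 = r 1 and s (k+2) = s 1 · s (k+1) − s k for all k ≥ 0. Let p ≥ 1 and l ≥ 0 with r l ≠ 0. Then the subsequence (r (l + n·p))_{n ∈ ℕ} is constant (equal to r l) if and only if s p = 2 and r (l + p) = r l. -/
/-- If `u` satisfies `u (k+2) = a · u (k+1) − u k` and `s` satisfies the same recursion with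
`s 0 = 2`, `s 1 = a`, then `u (k + 2p) = s p · u (k + p) − u k`. -/
theorem recursion_add_two_mul {R : Type*} [CommRing R] {a : R} {u s : ℕ → R}
    (hu : ∀ k, u (k + 2) = a * u (k + 1) - u k)
    (hs0 : s 0 = 2) (hs1 : s 1 = a) (hs : ∀ k, s (k + 2) = a * s (k + 1) - s k) (p k : ℕ) :
    u (k + 2 * p) = s p * u (k + p) - u k := by
  induction p using Nat.twoStepInduction generalizing k with
  | zero => simp only [hs0, mul_zero, add_zero]; ring
  | one => simpa only [hs1, mul_one] using hu k
  | more p ih₀ ih₁ =>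
    have h₀ := ih₀ (k + 2)
    have h₁ := ih₁ (k + 1)
    rw [show k + 2 + 2 * p = k + 2 * p + 2 by ring, show k + 2 + p = k + p + 2 by ring] at h₀
    rw [show k + 1 + 2 * (p + 1) = k + 2 * p + 3 by ring,
      show k + 1 + (p + 1) = k + p + 2 by ring] at h₁
    rw [show k + 2 * (p + 2) = k + 2 * p + 2 + 2 by ring, ← add_assoc k p 2, hs p]
    linear_combination hu (k + 2 * p + 2) + a * h₁ - h₀ + hu k

/-- **Corollary (periodic subsequences).**
Let `r : ℕ → ℝ` satisfy `r (k+2) = r 1 · r (k+1) − r k` and let `s : ℕ → ℝ` satisfy the same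
recursion with `s 0 = 2`, `s 1 = r 1`.  Let `p ≥ 1` and `l ≥ 0` with `r l ≠ 0`.  Then the
subsequence `(r (l + n·p))_{n}` is constant (equal to `r l`) if and only if `s p = 2` and
`r (l + p) = r l`. -/
theorem periodic_subsequence_iff
    (r s : ℕ → ℝ)
    (hr : ∀ k : ℕ, r (k + 2) = r 1 * r (k + 1) - r k)
    (hs0 : s 0 = 2) (hs1 : s 1 = r 1)
    (hs : ∀ k : ℕ, s (k + 2) = s 1 * s (k + 1) - s k)
    (p : ℕ) (hp : 1 ≤ p) (l : ℕ) (hl : r l ≠ 0) :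
    (∀ n : ℕ, r (l + n * p) = r l) ↔ (s p = 2 ∧ r (l + p) = r l) := by
  have key := recursion_add_two_mul hr hs0 hs1 (hs1 ▸ hs) p
  constructor
  · intro h
    have h₁ : r (l + p) = r l := by simpa using h 1
    refine ⟨mul_right_cancel₀ hl ?_, h₁⟩
    have h₂ := key l
    rw [h 2, h₁] at h₂
    linear_combination -h₂
  · rintro ⟨hsp, h₁⟩ n
    induction n using Nat.twoStepInduction with
    | zero => simp
    | one => simpa using h₁
    | more n ih₀ ih₁ =>
      have h₂ := key (l + n * p)
      rw [show l + n * p + 2 * p = l + (n + 2) * p by ring,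
        show l + n * p + p = l + (n + 1) * p by ring, ih₀, ih₁, hsp] at h₂
      linear_combination h₂
end
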